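/- There exists an absolute constant K > 0 with the following property. Let G be a finite simple graph with no isolated vertices and m ≥ 2 edges, let 0 < α ≤ 1/3, let p° : V → ℝ≥0 with ∑_v p°(v) = 1, and set p* = PR(α, p°). Suppose γ > 0, s ≥ 1 with s ≤ m·γ/8, and there is a set S ⊆ V with vol(S) ≤ s and p*(S) − vol(S)/(2m) ≥ γ. Then there exists a nonempty set T ⊆ V with vol(T) ≤ 8s/γ, p*(T) − vol(T)/(2m) ≥ γ/(16·log₂(4s)), and Φ(T) ≤ K·sqrt(α·log₂ m / γ). -/

import Mathlib

open scoped Classical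
open Finset

noncomputable section

variable {V : Type*} [Fintype V]

/-- The set of edges of `G` with exactly one endpoint in `S`. -/
def bdry (G : SimpleGraph V) (S : Finset V) : Finset (Sym2 V) :=
  G.edgeFinset.filter fun e => ∃ u v, u ∈ S ∧ v ∉ S ∧ e = s(u, v)

/-- The volume of `S`: the sum of the degrees of the vertices of `S`. -/
def vol (G : SimpleGraph V) (S : Finset V) : ℕ := ∑ v ∈ S, G.degree v

/-- The conductance `Φ(S) = |∂S| / min(vol S, 2m − vol S)`. -/
def conduct (G : SimpleGraph V) (S : Finset V) : ℝ :=
  ((bdry G S).card : ℝ) /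
    ((min (vol G S) (2 * G.edgeFinset.card - vol G S) : ℕ) : ℝ)

/-- The lazy random walk operator: `(W q)(v) = q(v)/2 + ∑_{u ~ v} q(u)/(2 d(u))`. -/
def lazyWalk (G : SimpleGraph V) (q : V → ℝ) : V → ℝ := fun v =>
  q v / 2 + ∑ u ∈ G.neighborFinset v, q u / (2 * (G.degree u : ℝ))

/-- The PageRank limit distribution `PR(α, p°) = α ∑_{k≥0} (1−α)^k (p° W^k)`. -/
def PR (G : SimpleGraph V) (α : ℝ) (p0 : V → ℝ) : V → ℝ := fun v =>
  α * ∑' k : ℕ, (1 - α) ^ k * (lazyWalk G)^[k] p0 v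

lemma concaveOn_affine_add_log {δ l B : ℝ} (hB : 0 ≤ B) :
    ConcaveOn ℝ (Set.Ici 0) fun x : ℝ => δ + l * x + B * Real.log (1 + x) := by
  refine ⟨convex_Ici 0, fun x hx y hy a b ha hb hab => ?_⟩
  simp only [Set.mem_Ici, smul_eq_mul] at *
  have h := strictConcaveOn_log_Ioi.concaveOn.2 (x := 1 + x) (y := 1 + y)
    (by simp; linarith) (by simp; linarith) ha hb hab
  simp only [smul_eq_mul] at h
  rw [show a * (1 + x) + b * (1 + y) = 1 + (a * x + b * y) by linear_combination hab] at h
  have hδ : a * δ + b * δ = δ := by rw [← add_mul, hab, one_mul]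
  nlinarith [mul_le_mul_of_nonneg_left h hB]

/-- A bound for all vertex sets extends to fractional vertex sets, by concavity. -/
lemma weighted_sum_sub_le {a d : V → ℝ} (hd : ∀ v, 0 ≤ d v) {f : ℝ → ℝ}
    (hf : ConcaveOn ℝ (Set.Ici 0) f) {M : ℝ}
    (h : ∀ T : Finset V, ∑ v ∈ T, a v - f (∑ v ∈ T, d v) ≤ M) {w : V → ℝ}
    (hw0 : ∀ v, 0 ≤ w v) (hw1 : ∀ v, w v ≤ 1) :
    ∑ v, w v * a v - f (∑ v, w v * d v) ≤ M := by
  have hconv : ConvexOn ℝ {w : V → ℝ | ∀ v, 0 ≤ w v}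
      fun w => ∑ v, w v * a v - f (∑ v, w v * d v) := by
    refine ⟨fun x hx y hy b c hb hc _ v => ?_, fun x hx y hy b c hb hc hbc => ?_⟩
    · exact add_nonneg (mul_nonneg hb (hx v)) (mul_nonneg hc (hy v))
    · have hsum : ∀ g : V → ℝ, ∑ v, (b • x + c • y) v * g v =
          b * ∑ v, x v * g v + c * ∑ v, y v * g v := fun g => by
        rw [mul_sum, mul_sum, ← sum_add_distrib]
        exact sum_congr rfl fun v _ => by simp; ring
      have := hf.2 (x := ∑ v, x v * d v) (y := ∑ v, y v * d v)
        (sum_nonneg fun v _ => mul_nonneg (hx v) (hd v))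
        (sum_nonneg fun v _ => mul_nonneg (hy v) (hd v)) hb hc hbc
      simp only [smul_eq_mul, hsum] at this ⊢
      linarith
  have hmem : w ∈ convexHull ℝ (Set.univ.pi fun _ : V => ({0, 1} : Set ℝ)) := by
    rw [convexHull_pi]
    intro v _
    rw [convexHull_pair, segment_eq_Icc zero_le_one]
    exact ⟨hw0 v, hw1 v⟩
  have hcube : ∀ y ∈ Set.univ.pi fun _ : V => ({0, 1} : Set ℝ), ∀ v, y v = 0 ∨ y v = 1 :=
    fun y hy v => by simpa using hy v (Set.mem_univ v)
  obtain ⟨y, hy, hle⟩ := hconv.exists_ge_of_mem_convexHull (fun y hy v => by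
    rcases hcube y hy v with h | h <;> simp [h]) hmem
  have hsum : ∀ g : V → ℝ, ∑ v, y v * g v = ∑ v ∈ univ.filter fun v => y v = 1, g v :=
      fun g => by
    rw [sum_filter]
    refine sum_congr rfl fun v _ => ?_
    rcases hcube y hy v with h | h <;> simp [h]
  simp only [hsum] at hle
  exact hle.trans (h _)

/-- The number of neighbors of `u` inside `T`. -/
def degIn (G : SimpleGraph V) (T : Finset V) (u : V) : ℕ := #{v ∈ T | G.Adj u v}

lemma degIn_le_degree (G : SimpleGraph V) (T : Finset V) (u : V) :
    degIn G T u ≤ G.degree u := by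
  rw [degIn, ← G.card_neighborFinset_eq_degree]
  exact card_le_card fun v hv => by simpa using (mem_filter.1 hv).2

lemma degIn_univ (G : SimpleGraph V) (u : V) : degIn G univ u = G.degree u := by
  rw [degIn, ← G.card_neighborFinset_eq_degree, G.neighborFinset_eq_filter]

lemma sum_degIn (G : SimpleGraph V) (T : Finset V) : ∑ u, degIn G T u = vol G T := by
  simp only [degIn, vol, card_filter]
  rw [sum_comm]
  refine sum_congr rfl fun v _ => ?_
  rw [← G.card_neighborFinset_eq_degree, G.neighborFinset_eq_filter, card_filter]
  simp only [G.adj_comm]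

lemma card_bdry (G : SimpleGraph V) (T : Finset V) :
    (bdry G T).card = ∑ u ∈ Tᶜ, degIn G T u := by
  have h : bdry G T = ((Tᶜ ×ˢ T).filter fun e => G.Adj e.1 e.2).image fun e => s(e.1, e.2) := by
    ext e
    simp only [bdry, mem_filter, mem_image, mem_product, mem_compl, SimpleGraph.mem_edgeFinset,
      Prod.exists]
    constructor
    · rintro ⟨he, u, v, hu, hv, rfl⟩
      exact ⟨v, u, ⟨⟨hv, hu⟩, (G.mem_edgeSet.1 he).symm⟩, Sym2.eq_swap⟩
    · rintro ⟨u, v, ⟨⟨hu, hv⟩, hadj⟩, rfl⟩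
      exact ⟨G.mem_edgeSet.2 hadj, v, u, hv, hu, Sym2.eq_swap⟩
  rw [h, card_image_of_injOn]
  · simp only [degIn, card_filter, sum_product]
  · rintro ⟨a, b⟩ hab ⟨c, d⟩ hcd heq
    simp only [coe_filter, mem_product, mem_compl, Set.mem_ofPred_eq] at hab hcd
    rcases Sym2.eq_iff.1 heq with ⟨rfl, rfl⟩ | ⟨rfl, rfl⟩
    · rfl
    · exact absurd hcd.1.2 hab.1.1

lemma sum_degIn_mem_add_card_bdry (G : SimpleGraph V) (T : Finset V) :
    ∑ u ∈ T, degIn G T u + (bdry G T).card = vol G T := by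
  rw [card_bdry, sum_add_sum_compl, sum_degIn]

lemma sum_lazyWalk (G : SimpleGraph V) (q : V → ℝ) (T : Finset V) :
    ∑ v ∈ T, lazyWalk G q v =
      (∑ v ∈ T, q v + ∑ u, (degIn G T u : ℝ) / G.degree u * q u) / 2 := by
  have h : ∑ v ∈ T, ∑ u ∈ G.neighborFinset v, q u / (2 * (G.degree u : ℝ)) =
      ∑ u, (degIn G T u : ℝ) / G.degree u * q u / 2 := by
    simp only [G.neighborFinset_eq_filter, sum_filter]
    rw [sum_comm]
    refine sum_congr rfl fun u _ => ?_
    rw [← sum_filter, sum_const, nsmul_eq_mul]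
    simp only [degIn, G.adj_comm u]
    ring
  simp only [lazyWalk]
  rw [sum_add_distrib, h, ← sum_div, ← sum_div]
  ring

lemma lazyWalk_nonneg (G : SimpleGraph V) {q : V → ℝ} (hq : ∀ v, 0 ≤ q v) (v : V) :
    0 ≤ lazyWalk G q v :=
  add_nonneg (div_nonneg (hq v) zero_le_two)
    (sum_nonneg fun u _ => div_nonneg (hq u) (by positivity))

lemma sum_univ_lazyWalk {G : SimpleGraph V} (hG : ∀ v, 0 < G.degree v) (q : V → ℝ) :
    ∑ v, lazyWalk G q v = ∑ v, q v := by
  have h : ∀ u, (G.degree u : ℝ) / G.degree u = 1 := fun u =>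
    div_self (Nat.cast_ne_zero.2 (hG u).ne')
  simp [sum_lazyWalk, degIn_univ, h]

lemma iterate_lazyWalk_nonneg (G : SimpleGraph V) {q : V → ℝ} (hq : ∀ v, 0 ≤ q v) (k : ℕ) :
    ∀ v, 0 ≤ (lazyWalk G)^[k] q v := by
  induction k with
  | zero => exact hq
  | succ k ih => rw [Function.iterate_succ_apply']; exact lazyWalk_nonneg G ih

lemma sum_iterate_lazyWalk {G : SimpleGraph V} (hG : ∀ v, 0 < G.degree v) (q : V → ℝ) (k : ℕ) :
    ∑ v, (lazyWalk G)^[k] q v = ∑ v, q v := by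
  induction k with
  | zero => rfl
  | succ k ih => rw [Function.iterate_succ_apply', sum_univ_lazyWalk hG, ih]

lemma summable_PR {G : SimpleGraph V} (hG : ∀ v, 0 < G.degree v) {α : ℝ} (hα0 : 0 < α)
    (hα1 : α ≤ 1) {p : V → ℝ} (hp : ∀ v, 0 ≤ p v) (v : V) :
    Summable fun k : ℕ => (1 - α) ^ k * (lazyWalk G)^[k] p v := by
  refine Summable.of_nonneg_of_le
    (fun k => mul_nonneg (pow_nonneg (by linarith) k) (iterate_lazyWalk_nonneg G hp k v))
    (fun k => mul_le_mul_of_nonneg_left ?_ (pow_nonneg (by linarith) k))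
    ((summable_geometric_of_lt_one (r := 1 - α) (by linarith) (by linarith)).mul_right
      (∑ v, p v))
  rw [← sum_iterate_lazyWalk hG p k]
  exact single_le_sum (fun u _ => iterate_lazyWalk_nonneg G hp k u) (mem_univ v)

lemma PR_nonneg (G : SimpleGraph V) {α : ℝ} (hα0 : 0 < α) (hα1 : α ≤ 1) {p : V → ℝ}
    (hp : ∀ v, 0 ≤ p v) (v : V) : 0 ≤ PR G α p v :=
  mul_nonneg hα0.le (tsum_nonneg fun k =>
    mul_nonneg (pow_nonneg (by linarith) k) (iterate_lazyWalk_nonneg G hp k v))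

lemma sum_PR {G : SimpleGraph V} (hG : ∀ v, 0 < G.degree v) {α : ℝ} (hα0 : 0 < α)
    (hα1 : α ≤ 1) {p : V → ℝ} (hp : ∀ v, 0 ≤ p v) : ∑ v, PR G α p v = ∑ v, p v := by
  simp only [PR]
  rw [← mul_sum, ← Summable.tsum_finsetSum fun v _ => summable_PR hG hα0 hα1 hp v]
  simp only [← mul_sum, sum_iterate_lazyWalk hG]
  rw [tsum_mul_right, tsum_geometric_of_lt_one (by linarith) (by linarith)]
  rw [sub_sub_cancel]
  field_simp

/-- PageRank is a fixed point of the walk with restarts. -/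
lemma PR_eq {G : SimpleGraph V} (hG : ∀ v, 0 < G.degree v) {α : ℝ} (hα0 : 0 < α)
    (hα1 : α ≤ 1) {p : V → ℝ} (hp : ∀ v, 0 ≤ p v) (v : V) :
    PR G α p v = α * p v + (1 - α) * lazyWalk G (PR G α p) v := by
  have hs := summable_PR hG hα0 hα1 hp
  have hW : HasSum (fun k : ℕ => (1 - α) ^ k * (lazyWalk G)^[k + 1] p v)
      (lazyWalk G (fun u => ∑' k : ℕ, (1 - α) ^ k * (lazyWalk G)^[k] p u) v) := by
    have h := ((hs v).hasSum.div_const 2).add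
      (hasSum_sum (s := G.neighborFinset v) fun u _ =>
        (hs u).hasSum.div_const (2 * (G.degree u : ℝ)))
    refine h.congr_fun ?_
    intro k
    rw [Function.iterate_succ_apply']
    simp only [lazyWalk, mul_add, mul_sum, mul_div_assoc]
  have hlin : lazyWalk G (PR G α p) v =
      α * lazyWalk G (fun u => ∑' k : ℕ, (1 - α) ^ k * (lazyWalk G)^[k] p u) v := by
    simp only [lazyWalk, PR, mul_add, mul_sum, mul_div_assoc]
  rw [hlin, ← hW.tsum_eq]
  simp only [PR]
  rw [(hs v).tsum_eq_zero_add]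
  simp only [pow_zero, one_mul, Function.iterate_zero, id_eq, pow_succ', mul_assoc]
  rw [tsum_mul_left]
  ring

/-- A Lovász–Simonovits type step: if `q(T) − f(vol T)` is at most `M` for all `T`, then one step
of the walk obeys the bound averaged over the volumes `vol T ± |∂T|`. -/
lemma sum_lazyWalk_le {G : SimpleGraph V} (hG : ∀ v, 0 < G.degree v) {q : V → ℝ} {f : ℝ → ℝ}
    (hf : ConcaveOn ℝ (Set.Ici 0) f) {M : ℝ}
    (h : ∀ T : Finset V, ∑ v ∈ T, q v - f (vol G T) ≤ M) (T : Finset V) :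
    ∑ v ∈ T, lazyWalk G q v ≤ M + (f ((vol G T : ℝ) - (bdry G T).card) +
      f ((vol G T : ℝ) + (bdry G T).card)) / 2 := by
  have hd : ∀ u, (G.degree u : ℝ) ≠ 0 := fun u => Nat.cast_ne_zero.2 (hG u).ne'
  have hr0 : ∀ u, 0 ≤ (degIn G T u : ℝ) / G.degree u := fun u => by positivity
  have hr1 : ∀ u, (degIn G T u : ℝ) / G.degree u ≤ 1 := fun u =>
    div_le_one_of_le₀ (Nat.cast_le.2 (degIn_le_degree G T u)) (Nat.cast_nonneg _)
  have h' : ∀ T : Finset V, ∑ v ∈ T, q v - f (∑ v ∈ T, (G.degree v : ℝ)) ≤ M := fun T => by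
    simpa [vol] using h T
  have hin := weighted_sum_sub_le (fun v => Nat.cast_nonneg (G.degree v)) hf h'
    (w := fun u => if u ∈ T then (degIn G T u : ℝ) / G.degree u else 0)
    (fun u => by split_ifs <;> simp [hr0]) (fun u => by split_ifs <;> simp [hr1])
  have hout := weighted_sum_sub_le (fun v => Nat.cast_nonneg (G.degree v)) hf h'
    (w := fun u => if u ∈ T then 1 else (degIn G T u : ℝ) / G.degree u)
    (fun u => by split_ifs <;> simp [hr0]) (fun u => by split_ifs <;> simp [hr1])
  have hbd : ∑ u ∈ T, (degIn G T u : ℝ) + (bdry G T).card = vol G T := by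
    exact_mod_cast sum_degIn_mem_add_card_bdry G T
  have hcb : ((bdry G T).card : ℝ) = ∑ u ∈ Tᶜ, (degIn G T u : ℝ) := by
    exact_mod_cast card_bdry G T
  have hvol : (vol G T : ℝ) = ∑ u ∈ T, (G.degree u : ℝ) := by simp [vol]
  have hvin : ∑ u, (if u ∈ T then (degIn G T u : ℝ) / G.degree u else 0) * G.degree u =
      (vol G T : ℝ) - (bdry G T).card := by
    rw [← hbd, add_sub_cancel_right]
    simp [ite_mul, div_mul_cancel₀ _ (hd _)]
  have hvout : ∑ u, (if u ∈ T then 1 else (degIn G T u : ℝ) / G.degree u) * G.degree u =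
      (vol G T : ℝ) + (bdry G T).card := by
    rw [hcb, hvol, ← sum_add_sum_compl T]
    refine congr_arg₂ _ (sum_congr rfl fun u hu => by simp [hu])
      (sum_congr rfl fun u hu => ?_)
    rw [if_neg (mem_compl.1 hu), div_mul_cancel₀ _ (hd u)]
  have hq : ∑ u, (if u ∈ T then (degIn G T u : ℝ) / G.degree u else 0) * q u +
      ∑ u, (if u ∈ T then 1 else (degIn G T u : ℝ) / G.degree u) * q u =
      ∑ v ∈ T, q v + ∑ u, (degIn G T u : ℝ) / G.degree u * q u := by
    rw [← univ_inter T, ← sum_ite_mem univ T q, ← sum_add_distrib, ← sum_add_distrib]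
    refine sum_congr rfl fun u _ => ?_
    by_cases hu : u ∈ T <;> simp [hu, add_comm]
  rw [hvin] at hin
  rw [hvout] at hout
  rw [sum_lazyWalk, ← hq]
  linarith

lemma log_sub_add_log_add_le {v b φ : ℝ} (hφ : 0 < φ) (hv : 1 ≤ v) (hbv : b ≤ v)
    (hb : φ * v < b) :
    Real.log (1 + (v - b)) + Real.log (1 + (v + b)) < 2 * Real.log (1 + v) - φ ^ 2 / 4 := by
  have hb0 : 0 < b := lt_of_le_of_lt (by positivity) hb
  have h1 : 0 < 1 + v := by linarith
  have hm : (1 + v) ^ 2 ≠ 0 := by positivity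
  have hx : 0 < (1 + (v - b)) * (1 + (v + b)) := mul_pos (by linarith) (by linarith)
  rw [← Real.log_mul (by linarith) (by linarith)]
  have hl := Real.log_le_sub_one_of_pos (div_pos hx (by positivity : 0 < (1 + v) ^ 2))
  rw [Real.log_div hx.ne' hm, Real.log_pow] at hl
  have heq : (1 + (v - b)) * (1 + (v + b)) / (1 + v) ^ 2 - 1 = -(b / (1 + v)) ^ 2 := by
    field_simp
    ring
  have hlt : φ / 2 < b / (1 + v) := by
    rw [lt_div_iff₀ h1]
    nlinarith
  have hsq : (φ / 2) ^ 2 < (b / (1 + v)) ^ 2 := by gcongr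
  push_cast at hl
  linarith

theorem stmt15 :
    ∃ K : ℝ, 0 < K ∧
      ∀ (V : Type) [Fintype V], ∀ (G : SimpleGraph V) (m : ℕ),
        m = G.edgeFinset.card → 2 ≤ m →
        (∀ v : V, 0 < G.degree v) →
        ∀ (α : ℝ), 0 < α → α ≤ 1 / 3 →
        ∀ (p0 : V → ℝ), (∀ v, 0 ≤ p0 v) → (∑ v, p0 v) = 1 →
        ∀ (γ : ℝ), 0 < γ →
        ∀ (s : ℝ), 1 ≤ s → s ≤ (m : ℝ) * γ / 8 →
        ∀ (S : Finset V),
          (vol G S : ℝ) ≤ s →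
          γ ≤ (∑ v ∈ S, PR G α p0 v) - (vol G S : ℝ) / (2 * (m : ℝ)) →
          ∃ T : Finset V, T.Nonempty ∧
            (vol G T : ℝ) ≤ 8 * s / γ ∧
            γ / (16 * Real.logb 2 (4 * s)) ≤
              (∑ v ∈ T, PR G α p0 v) - (vol G T : ℝ) / (2 * (m : ℝ)) ∧
            conduct G T ≤ K * Real.sqrt (α * Real.logb 2 (m : ℝ) / γ) := by
  refine ⟨4, by norm_num, ?_⟩
  intro V _ G m hm hm2 hG α hα0 hα1 p0 hp0 hp0sum γ hγ s hs1 hs S hSvol hS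
  have hm2' : (2 : ℝ) ≤ m := by exact_mod_cast hm2
  have hα1' : α ≤ 1 := by linarith
  set p := PR G α p0 with hp
  have hpnn : ∀ v, 0 ≤ p v := PR_nonneg G hα0 hα1' hp0
  have hp1 : ∀ T : Finset V, ∑ v ∈ T, p v ≤ 1 := fun T => by
    rw [← hp0sum, ← sum_PR hG hα0 hα1' hp0]
    exact sum_le_univ_sum_of_nonneg hpnn
  have hp01 : ∀ T : Finset V, ∑ v ∈ T, p0 v ≤ 1 := fun T => by
    rw [← hp0sum]
    exact sum_le_univ_sum_of_nonneg hp0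
  have hlm : 0 < Real.logb 2 (m : ℝ) := Real.logb_pos one_lt_two (by linarith)
  have hls : 2 ≤ Real.logb 2 (4 * s) := by
    rw [Real.le_logb_iff_rpow_le one_lt_two (by linarith)]
    norm_num
    linarith
  set δ := γ / (16 * Real.logb 2 (4 * s)) with hδ
  have hδ0 : 0 < δ := by positivity
  have hδle : δ ≤ γ / 32 := by
    rw [hδ]
    gcongr
    linarith
  set φ := 4 * Real.sqrt (α * Real.logb 2 (m : ℝ) / γ) with hφ
  have hφ0 : 0 < φ := by positivity
  have hφsq : φ ^ 2 = 16 * (α * Real.logb 2 (m : ℝ) / γ) := by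
    rw [hφ, mul_pow, Real.sq_sqrt (by positivity)]
    norm_num
  set B := 8 * α / φ ^ 2 with hB
  have hB0 : 0 < B := by positivity
  have hBφ : B * φ ^ 2 = 8 * α := div_mul_cancel₀ _ (by positivity)
  have hBeq : B * Real.logb 2 (m : ℝ) = γ / 2 := by
    rw [hB, hφsq]
    field_simp
    norm_num
  by_contra hcon
  push Not at hcon
  set f : ℝ → ℝ := fun x => δ + γ / (8 * s) * x + B * Real.log (1 + x) with hf
  obtain ⟨T, hT⟩ := Finite.exists_max fun T : Finset V => ∑ v ∈ T, p v - f (vol G T)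
  have hm0 : (0 : ℝ) < m := by linarith
  have hslope : 1 / (2 * (m : ℝ)) ≤ γ / (8 * s) := by
    rw [div_le_div_iff₀ (by positivity) (by positivity)]
    nlinarith
  have hlog1 : Real.log 2 ≤ 1 := by linarith [Real.log_two_lt_d9]
  have hFS : 0 < ∑ v ∈ S, p v - f (vol G S) := by
    have hγ1 : γ ≤ 1 := by
      have : (0 : ℝ) ≤ (vol G S : ℝ) / (2 * m) := by positivity
      linarith [hp1 S]
    have hlin : γ / (8 * s) * vol G S ≤ γ / 8 := by
      calc γ / (8 * s) * vol G S ≤ γ / (8 * s) * s := by gcongr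
        _ = γ / 8 := by field_simp
    have hlog : Real.log (1 + (vol G S : ℝ)) ≤ Real.logb 2 (m : ℝ) := by
      have h1 : Real.log (1 + (vol G S : ℝ)) ≤ Real.log m :=
        Real.log_le_log (by positivity) (by nlinarith)
      have h2 : Real.log (m : ℝ) ≤ Real.logb 2 (m : ℝ) := by
        rw [Real.logb, le_div_iff₀ (Real.log_pos one_lt_two)]
        nlinarith [Real.log_nonneg (by linarith : (1 : ℝ) ≤ m)]
      linarith
    have hBl := mul_le_mul_of_nonneg_left hlog hB0.le
    have : (0 : ℝ) ≤ (vol G S : ℝ) / (2 * m) := by positivity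
    simp only [hf]
    linarith
  have hFT := hFS.trans_le (hT S)
  set v : ℝ := (vol G T : ℝ) with hv
  have hv0 : 0 ≤ v := Nat.cast_nonneg _
  have hlogv : 0 ≤ B * Real.log (1 + v) := mul_nonneg hB0.le (Real.log_nonneg (by linarith))
  have hfv : δ + γ / (8 * s) * v ≤ f v := by simp only [hf]; linarith
  have hne : T.Nonempty := by
    rw [nonempty_iff_ne_empty]
    rintro rfl
    have : 0 ≤ γ / (8 * s) * v := by positivity
    simp only [sum_empty] at hFT
    linarith
  have hvle : v ≤ 8 * s / γ := by
    by_contra! hlt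
    have : 1 ≤ γ / (8 * s) * v := by
      rw [div_lt_iff₀ hγ] at hlt
      rw [div_mul_eq_mul_div, le_div_iff₀ (by positivity)]
      linarith
    linarith [hp1 T]
  have hexc : δ ≤ ∑ v ∈ T, p v - v / (2 * m) := by
    have := mul_le_mul_of_nonneg_right hslope hv0
    rw [one_div_mul_eq_div] at this
    linarith
  have hv1 : 1 ≤ v := by
    obtain ⟨x, hx⟩ := hne
    have : 1 ≤ vol G T := (hG x).trans_le
      (single_le_sum (f := fun v => G.degree v) (fun _ _ => Nat.zero_le _) hx)
    rw [hv]
    exact_mod_cast this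
  have hcond := hcon T hne hvle hexc
  have hvm : v ≤ m := hvle.trans (by rw [div_le_iff₀ hγ]; linarith)
  have hvm' : vol G T ≤ m := by
    rw [hv] at hvm
    exact_mod_cast hvm
  have hbd : φ * v < (bdry G T).card := by
    rw [conduct, ← hm, min_eq_left (by omega), lt_div_iff₀ (by linarith)] at hcond
    exact hcond
  have hbv : ((bdry G T).card : ℝ) ≤ v := by
    rw [hv, ← sum_degIn_mem_add_card_bdry G T]
    exact_mod_cast Nat.le_add_left _ _
  have hstep := sum_lazyWalk_le hG (concaveOn_affine_add_log hB0.le) hT T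
  have hfix : ∑ v ∈ T, p v = α * ∑ v ∈ T, p0 v + (1 - α) * ∑ v ∈ T, lazyWalk G p v := by
    rw [mul_sum, mul_sum, ← sum_add_distrib]
    exact sum_congr rfl fun v _ => PR_eq hG hα0 hα1' hp0 v
  have hWnn : 0 ≤ ∑ v ∈ T, lazyWalk G p v := sum_nonneg fun v _ => lazyWalk_nonneg G hpnn v
  have hle : ∑ v ∈ T, p v ≤ α + ∑ v ∈ T, lazyWalk G p v := by
    nlinarith [hp01 T]
  have hlogs := mul_lt_mul_of_pos_left (log_sub_add_log_add_le hφ0 hv1 hbv hbd) hB0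
  simp only [hf] at hstep hle
  rw [← hv] at hstep
  linarith

end
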